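/- arXiv:1209.0039 — 5 statements merged into one kernel-verified Lean document; each statement's English description precedes it below -/
import Mathlib

section
/- Let A, B, C be nonempty subsets of the state space Ω of an irreducible finite Markov chain and let T > 0 be a real number such that d⁺(Ω,B) ≤ T, d⁺(Ω, A∪C) ≤ T, d⁺(Ω,A) ≤ 99.9·T and d⁻(B,A) ≥ 98.9·T. Then d⁺(B,C) < 14·T. -/
/-- `P` is a row-stochastic transition matrix on the finite state space `Ω`. -/
def IsTransitionMatrix {Ω : Type*} [Fintype Ω] (P : Matrix Ω Ω ℝ) : Prop :=
  (∀ x y, 0 ≤ P x y) ∧ ∀ x, ∑ y, P x y = 1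

/-- The chain is irreducible: any state can reach any other state. -/
def IsIrreducibleChain {Ω : Type*} [Fintype Ω] [DecidableEq Ω] (P : Matrix Ω Ω ℝ) : Prop :=
  ∀ x y, ∃ n : ℕ, 0 < (P ^ n) x y

/-- `π` is a stationary distribution for `P`. -/
def IsStationaryDist {Ω : Type*} [Fintype Ω] (P : Matrix Ω Ω ℝ) (π : Ω → ℝ) : Prop :=
  (∀ x, 0 ≤ π x) ∧ (∑ x, π x = 1) ∧ ∀ y, ∑ x, π x * P x y = π y

/-- The expected hitting time `E_x[τ_A] = ∑_{t=0}^∞ ∑_{y ∉ A} Qᵗ(x,y)`, where `Q` is `P`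
with rows and columns indexed by `A` replaced by zero. -/
noncomputable def hitTime {Ω : Type*} [Fintype Ω] [DecidableEq Ω]
    (P : Matrix Ω Ω ℝ) (A : Finset Ω) (x : Ω) : ℝ :=
  ∑' t : ℕ, ∑ y ∈ Aᶜ, (((Matrix.of fun u v => if u ∈ A ∨ v ∈ A then (0:ℝ) else P u v)) ^ t) x y

/-- `T(α)`: the maximum expected hitting time of a set of stationary measure at least `α`. -/
noncomputable def Tfun {Ω : Type*} [Fintype Ω] [DecidableEq Ω]
    (P : Matrix Ω Ω ℝ) (π : Ω → ℝ) (α : ℝ) : ℝ :=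
  sSup {r | ∃ (x : Ω) (A : Finset Ω), α ≤ ∑ a ∈ A, π a ∧ r = hitTime P A x}

/-- `d⁺(A,B) = max_{x ∈ A} E_x[τ_B]`. -/
noncomputable def dplus {Ω : Type*} [Fintype Ω] [DecidableEq Ω]
    (P : Matrix Ω Ω ℝ) (A B : Finset Ω) : ℝ :=
  sSup {r | ∃ x ∈ A, r = hitTime P B x}

/-- `d⁻(A,B) = min_{x ∈ A} E_x[τ_B]`. -/
noncomputable def dminus {Ω : Type*} [Fintype Ω] [DecidableEq Ω]
    (P : Matrix Ω Ω ℝ) (A B : Finset Ω) : ℝ :=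
  sInf {r | ∃ x ∈ A, r = hitTime P B x}

/-- Minimum principle for irreducible chains. -/
lemma min_principle {Ω : Type*} [Fintype Ω] [DecidableEq Ω]
    (P : Matrix Ω Ω ℝ) (hP : IsTransitionMatrix P) (hirr : IsIrreducibleChain P)
    (S : Finset Ω) (hS : S.Nonempty) (f : Ω → ℝ) (h0 : ∀ x ∈ S, 0 ≤ f x)
    (h1 : ∀ x, x ∉ S → ∑ y, P x y * f y ≤ f x) : ∀ x, 0 ≤ f x := by
  obtain ⟨s, hs⟩ := hS
  obtain ⟨x0, -, hx0⟩ := Finset.exists_min_image Finset.univ f ⟨s, Finset.mem_univ s⟩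
  by_contra! hneg
  obtain ⟨z, hz⟩ := hneg
  have hm : f x0 < 0 := lt_of_le_of_lt (hx0 z (Finset.mem_univ z)) hz
  have step : ∀ x, f x = f x0 → ∀ y, 0 < P x y → f y = f x0 := by
    intro x hx y hy
    have hxS : x ∉ S := fun h => by have := h0 x h; linarith
    have h2 := h1 x hxS
    have h3 : ∑ y, P x y * (f y - f x0) ≤ 0 := by
      have : ∑ y, P x y * (f y - f x0) = ∑ y, P x y * f y - (∑ y, P x y) * f x0 := by
        rw [Finset.sum_mul, ← Finset.sum_sub_distrib]
        exact Finset.sum_congr rfl fun y _ => by ring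
      rw [this, hP.2 x]; linarith
    have hnn : ∀ y ∈ Finset.univ, 0 ≤ P x y * (f y - f x0) := fun y hy =>
      mul_nonneg (hP.1 x y) (sub_nonneg.2 (hx0 y hy))
    have h4 := Finset.single_le_sum hnn (Finset.mem_univ y)
    have h5 := hx0 y (Finset.mem_univ y)
    by_contra hne
    have h6 : 0 < f y - f x0 := sub_pos.2 (lt_of_le_of_ne h5 (Ne.symm hne))
    have := mul_pos hy h6
    linarith
  have key : ∀ n : ℕ, ∀ y, 0 < (P ^ n) x0 y → f y = f x0 := by
    intro n
    induction n with
    | zero =>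
      intro y hy
      by_cases h : x0 = y
      · rw [h]
      · simp [Matrix.one_apply, h] at hy
    | succ n ih =>
      intro y hy
      rw [pow_succ, Matrix.mul_apply] at hy
      obtain ⟨k, -, hk⟩ := Finset.exists_lt_of_sum_lt (f := fun _ => (0:ℝ)) (by simpa using hy)
      have hkk : P k y ≠ 0 := fun h => by simp [h] at hk
      have hp : 0 < P k y := lt_of_le_of_ne (hP.1 k y) (Ne.symm hkk)
      exact step k (ih k (pos_of_mul_pos_left hk hp.le)) y hp
  obtain ⟨n, hn⟩ := hirr x0 s
  have := key n s hn
  have := h0 s hs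
  linarith

/-- The killed matrix. -/
def killed {Ω : Type*} [DecidableEq Ω] (P : Matrix Ω Ω ℝ) (A : Finset Ω) : Matrix Ω Ω ℝ :=
  Matrix.of fun u v => if u ∈ A ∨ v ∈ A then (0:ℝ) else P u v

lemma killed_mulVec_mem {Ω : Type*} [Fintype Ω] [DecidableEq Ω] (P : Matrix Ω Ω ℝ)
    (A : Finset Ω) (v : Ω → ℝ) (x : Ω) (hx : x ∈ A) : (killed P A).mulVec v x = 0 := by
  simp [Matrix.mulVec, dotProduct, killed, hx]

lemma killed_mulVec_notMem {Ω : Type*} [Fintype Ω] [DecidableEq Ω] (P : Matrix Ω Ω ℝ)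
    (A : Finset Ω) (v : Ω → ℝ) (hv : ∀ x ∈ A, v x = 0) (x : Ω) (hx : x ∉ A) :
    (killed P A).mulVec v x = ∑ y, P x y * v y := by
  simp only [Matrix.mulVec, dotProduct, killed, Matrix.of_apply]
  refine Finset.sum_congr rfl fun y _ => ?_
  by_cases hy : y ∈ A
  · simp [hv y hy]
  · simp [hx, hy]

lemma killed_nonneg {Ω : Type*} [Fintype Ω] [DecidableEq Ω] (P : Matrix Ω Ω ℝ)
    (hP : IsTransitionMatrix P) (A : Finset Ω) (v : Ω → ℝ) (hv : ∀ x, 0 ≤ v x) (t : ℕ) :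
    ∀ x, 0 ≤ ((killed P A) ^ t).mulVec v x := by
  induction t with
  | zero => simpa using hv
  | succ t ih =>
    intro x
    rw [pow_succ', ← Matrix.mulVec_mulVec]
    simp only [Matrix.mulVec, dotProduct] at ih ⊢
    refine Finset.sum_nonneg fun y _ => mul_nonneg ?_ (ih y)
    simp only [killed, Matrix.of_apply]
    split_ifs
    · exact le_rfl
    · exact hP.1 x y

lemma hit_exists {Ω : Type*} [Fintype Ω] [DecidableEq Ω]
    (P : Matrix Ω Ω ℝ) (hP : IsTransitionMatrix P) (hirr : IsIrreducibleChain P)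
    (A : Finset Ω) (hA : A.Nonempty) (w : Ω → ℝ) (hw : ∀ x, 0 ≤ w x)
    (hwA : ∀ x ∈ A, w x = 0) :
    ∃ g : Ω → ℝ, (∀ x, 0 ≤ g x) ∧ g = w + (killed P A).mulVec g := by
  have hinj : Function.Injective (1 - killed P A).mulVec := by
    intro u v huv
    have hd : ∀ u v : Ω → ℝ, (1 - killed P A).mulVec u = (1 - killed P A).mulVec v →
        ∀ x, 0 ≤ (u - v) x := by
      intro u v huv
      have h : u - v = (killed P A).mulVec (u - v) := by
        rw [Matrix.sub_mulVec, Matrix.sub_mulVec, Matrix.one_mulVec, Matrix.one_mulVec] at huv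
        rw [Matrix.mulVec_sub, sub_eq_sub_iff_sub_eq_sub]; exact huv
      have hz : ∀ x ∈ A, (u - v) x = 0 := fun x hx => by
        rw [h]; exact killed_mulVec_mem P A _ x hx
      refine min_principle P hP hirr A hA _ (fun x hx => (hz x hx).ge) fun x hx => ?_
      rw [← killed_mulVec_notMem P A _ hz x hx, ← h]
    funext x
    have h1 := hd u v huv x
    have h2 := hd v u huv.symm x
    simp only [Pi.sub_apply] at h1 h2
    linarith
  have hu := Matrix.mulVec_injective_iff_isUnit.1 hinj
  obtain ⟨g, hg⟩ := Matrix.mulVec_surjective_iff_isUnit.2 hu w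
  have h : g = w + (killed P A).mulVec g := by
    rw [← hg, Matrix.sub_mulVec, Matrix.one_mulVec]; simp
  have hz : ∀ x ∈ A, g x = 0 := fun x hx => by
    rw [h, Pi.add_apply, killed_mulVec_mem P A _ x hx, hwA x hx, add_zero]
  refine ⟨g, ?_, h⟩
  refine min_principle P hP hirr A hA _ (fun x hx => (hz x hx).ge) fun x hx => ?_
  rw [← killed_mulVec_notMem P A _ hz x hx]
  have := congrFun h x
  have := hw x
  simp only [Pi.add_apply] at *
  linarith

lemma hitTime_spec {Ω : Type*} [Fintype Ω] [DecidableEq Ω]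
    (P : Matrix Ω Ω ℝ) (hP : IsTransitionMatrix P) (hirr : IsIrreducibleChain P)
    (A : Finset Ω) (hA : A.Nonempty) :
    (∀ x, 0 ≤ hitTime P A x) ∧ (∀ x ∈ A, hitTime P A x = 0) ∧
      ∀ x, x ∉ A → hitTime P A x = 1 + ∑ y, P x y * hitTime P A y := by
  set w : Ω → ℝ := fun x => if x ∈ A then 0 else 1 with hwdef
  have hw : ∀ x, 0 ≤ w x := fun x => by simp only [hwdef]; split_ifs <;> norm_num
  have hwA : ∀ x ∈ A, w x = 0 := fun x hx => by simp [hwdef, hx]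
  obtain ⟨g, hg0, hg⟩ := hit_exists P hP hirr A hA w hw hwA
  have hform : ∀ x, hitTime P A x = ∑' t : ℕ, ((killed P A) ^ t).mulVec w x := by
    intro x
    unfold hitTime
    refine tsum_congr fun t => ?_
    simp only [Matrix.mulVec, dotProduct, hwdef, mul_ite, mul_zero, mul_one]
    symm
    rw [← Finset.sum_subset (Finset.subset_univ Aᶜ)]
    · refine Finset.sum_congr rfl fun y hy => ?_
      rw [if_neg (Finset.mem_compl.1 hy)]
      rfl
    · intro y _ hy
      rw [if_pos (by simpa using hy)]
  have hpart : ∀ n : ℕ, g = ∑ t ∈ Finset.range n, ((killed P A) ^ t).mulVec w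
      + ((killed P A) ^ n).mulVec g := by
    intro n
    induction n with
    | zero => simp
    | succ n ih =>
      rw [Finset.sum_range_succ, pow_succ, ← Matrix.mulVec_mulVec, add_assoc,
        ← Matrix.mulVec_add, ← hg]
      exact ih
  have hnn := killed_nonneg P hP A w hw
  have hsum : ∀ x, Summable fun t : ℕ => ((killed P A) ^ t).mulVec w x := by
    intro x
    refine summable_of_sum_range_le (c := g x) (fun t => hnn t x) fun n => ?_
    have h := congrFun (hpart n) x
    rw [Pi.add_apply, Finset.sum_apply] at h
    have := killed_nonneg P hP A g hg0 n x
    linarith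
  have hrec : ∀ x, hitTime P A x = w x + (killed P A).mulVec (hitTime P A) x := by
    intro x
    rw [hform x, (hsum x).tsum_eq_zero_add]
    congr 1
    · simp
    · simp only [pow_succ', ← Matrix.mulVec_mulVec]
      simp only [Matrix.mulVec, dotProduct]
      rw [Summable.tsum_finsetSum]
      · refine Finset.sum_congr rfl fun y _ => ?_
        rw [tsum_mul_left, hform y]; rfl
      · intro y _
        exact (hsum y).mul_left _
  have hz : ∀ x ∈ A, hitTime P A x = 0 := fun x hx => by
    rw [hrec, killed_mulVec_mem P A _ x hx, hwA x hx, add_zero]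
  refine ⟨fun x => ?_, hz, fun x hx => ?_⟩
  · rw [hform]; exact tsum_nonneg fun t => hnn t x
  · rw [hrec, killed_mulVec_notMem P A _ hz x hx]; simp [hwdef, hx]

lemma hitSet_finite {Ω : Type*} [Fintype Ω] [DecidableEq Ω]
    (P : Matrix Ω Ω ℝ) (A B : Finset Ω) : {r | ∃ x ∈ A, r = hitTime P B x}.Finite := by
  refine ((A.finite_toSet).image (hitTime P B)).subset ?_
  rintro r ⟨x, hx, rfl⟩
  exact ⟨x, hx, rfl⟩

/-- Let `A, B, C` be nonempty subsets of the state space `Ω` of an irreducible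
finite Markov chain and `T > 0` a real number with `d⁺(Ω,B) ≤ T`, `d⁺(Ω,A∪C) ≤ T`,
`d⁺(Ω,A) ≤ 99.9·T` and `d⁻(B,A) ≥ 98.9·T`. Then `d⁺(B,C) < 14·T`. -/
theorem dplus_B_C_lt {Ω : Type*} [Fintype Ω] [DecidableEq Ω] [Nonempty Ω]
    (P : Matrix Ω Ω ℝ) (hP : IsTransitionMatrix P) (hirr : IsIrreducibleChain P)
    (A B C : Finset Ω) (hA : A.Nonempty) (hB : B.Nonempty) (hC : C.Nonempty)
    (T : ℝ) (hT : 0 < T)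
    (h1 : dplus P Finset.univ B ≤ T)
    (h2 : dplus P Finset.univ (A ∪ C) ≤ T)
    (h3 : dplus P Finset.univ A ≤ (999/10) * T)
    (h4 : (989/10) * T ≤ dminus P B A) :
    dplus P B C < 14 * T := by
  have hle : ∀ (S D : Finset Ω) (x : Ω), x ∈ S → hitTime P D x ≤ dplus P S D := fun S D x hx =>
    le_csSup (hitSet_finite P S D).bddAbove ⟨x, hx, rfl⟩
  have hB1 : ∀ x, hitTime P B x ≤ T := fun x => (hle _ _ x (Finset.mem_univ x)).trans h1
  have hD1 : ∀ x, hitTime P (A ∪ C) x ≤ T := fun x => (hle _ _ x (Finset.mem_univ x)).trans h2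
  have hA1 : ∀ x, hitTime P A x ≤ (999/10) * T :=
    fun x => (hle _ _ x (Finset.mem_univ x)).trans h3
  have hA2 : ∀ x ∈ B, (989/10) * T ≤ hitTime P A x := fun x hx =>
    h4.trans (csInf_le (hitSet_finite P B A).bddBelow ⟨x, hx, rfl⟩)
  obtain ⟨b, hbB, hb⟩ := Finset.exists_max_image B (hitTime P C) hB
  obtain ⟨pA, zA, rA⟩ := hitTime_spec P hP hirr A hA
  obtain ⟨pB, zB, rB⟩ := hitTime_spec P hP hirr B hB
  obtain ⟨pC, zC, rC⟩ := hitTime_spec P hP hirr C hC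
  obtain ⟨pD, zD, rD⟩ := hitTime_spec P hP hirr (A ∪ C) (hA.mono Finset.subset_union_left)
  set M := hitTime P C b with hM
  have hM0 : 0 ≤ M := pC b
  have hlast : M < 14 * T → dplus P B C < 14 * T := by
    intro h
    refine lt_of_le_of_lt (csSup_le ⟨_, b, hbB, rfl⟩ ?_) h
    rintro r ⟨x, hx, rfl⟩
    exact hb x hx
  apply hlast
  -- hitting `C` by first going to `B`
  have hCB : ∀ x, 0 ≤ hitTime P B x + M - hitTime P C x := by
    refine min_principle P hP hirr (B ∪ C) (hB.mono Finset.subset_union_left) _ ?_ ?_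
    · intro x hx
      rcases Finset.mem_union.1 hx with h | h
      · have := hb x h
        have := pB x
        linarith
      · have := zC x h
        have := pB x
        linarith
    · intro x hx
      rw [Finset.mem_union, not_or] at hx
      have e : ∑ y, P x y * (hitTime P B y + M - hitTime P C y) =
          ∑ y, P x y * hitTime P B y + (∑ y, P x y) * M - ∑ y, P x y * hitTime P C y := by
        rw [Finset.sum_mul, ← Finset.sum_add_distrib, ← Finset.sum_sub_distrib]
        exact Finset.sum_congr rfl fun y _ => by ring
      rw [e, hP.2 x, rB x hx.1, rC x hx.2]
      linarith
  set K := (999/10) * T with hK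
  have hK0 : 0 < K := by positivity
  -- the main comparison on `A ∪ C`, multiplied by `K * (T + M)`
  have hmain : ∀ x, 0 ≤ K * (T + M) + (K + (T + M)) * hitTime P (A ∪ C) x
      - K * hitTime P C x - (T + M) * hitTime P A x := by
    refine min_principle P hP hirr (A ∪ C) (hA.mono Finset.subset_union_left) _ ?_ ?_
    · intro x hx
      rw [zD x hx]
      rcases Finset.mem_union.1 hx with h | h
      · rw [zA x h]
        have := hCB x
        have := hB1 x
        have : 0 ≤ K * (T + M - hitTime P C x) := mul_nonneg hK0.le (by linarith)
        linarith
      · rw [zC x h]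
        have : 0 ≤ (T + M) * (K - hitTime P A x) :=
          mul_nonneg (by linarith) (by have := hA1 x; linarith)
        linarith
    · intro x hx
      have hx' := hx
      rw [Finset.mem_union, not_or] at hx'
      have e : ∑ y, P x y * (K * (T + M) + (K + (T + M)) * hitTime P (A ∪ C) y
            - K * hitTime P C y - (T + M) * hitTime P A y) =
          (∑ y, P x y) * (K * (T + M)) + (K + (T + M)) * ∑ y, P x y * hitTime P (A ∪ C) y
            - K * ∑ y, P x y * hitTime P C y - (T + M) * ∑ y, P x y * hitTime P A y := by
        simp only [Finset.sum_mul, Finset.mul_sum]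
        rw [← Finset.sum_add_distrib, ← Finset.sum_sub_distrib, ← Finset.sum_sub_distrib]
        exact Finset.sum_congr rfl fun y _ => by ring
      rw [e, hP.2 x, rD x hx, rC x hx'.2, rA x hx'.1]
      linarith
  have hfin := hmain b
  rw [← hM] at hfin
  have i1 : (K + (T + M)) * hitTime P (A ∪ C) b ≤ (K + (T + M)) * T :=
    mul_le_mul_of_nonneg_left (hD1 b) (by linarith)
  have i2 : (T + M) * ((989/10) * T) ≤ (T + M) * hitTime P A b :=
    mul_le_mul_of_nonneg_left (hA2 b hbB) (by linarith)
  by_contra! hcon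
  have i3 : 14 * T * T ≤ M * T := mul_le_mul_of_nonneg_right hcon hT.le
  have i4 : 0 < T * T := mul_pos hT hT
  rw [hK] at hfin i1
  nlinarith
end

section
/- For every 0 < α < β ≤ 1/2 there exists an irreducible Markov chain on a finite state space (with at least two states) for which T(α) = T(β) + (α⁻¹ − 1)·T(1−β) = T(β)/α; that is, the inequalities T(α) ≤ T(β) + (α⁻¹−1)·T(1−β) ≤ T(β)/α are simultaneously attained with equality. -/
open Filter Topology in
theorem hitTime_eq_of_harmonic {Ω : Type*} [Fintype Ω] [DecidableEq Ω]
    (P : Matrix Ω Ω ℝ) (A : Finset Ω) (hP : ∀ x y, 0 ≤ P x y) (h : Ω → ℝ)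
    (h0 : ∀ x, 0 ≤ h x) (hA : ∀ x ∈ A, h x = 0)
    (hh : ∀ x, x ∉ A → h x = 1 + ∑ y, P x y * h y) (x : Ω) : hitTime P A x = h x := by
  unfold hitTime
  set Q : Matrix Ω Ω ℝ := Matrix.of fun u v => if u ∈ A ∨ v ∈ A then (0:ℝ) else P u v with hQ
  have hQ0 : ∀ u v, 0 ≤ Q u v := by
    intro u v
    simp only [hQ, Matrix.of_apply]
    split_ifs
    · exact le_rfl
    · exact hP u v
  have hQn : ∀ n u v, 0 ≤ (Q ^ n) u v := by
    intro n
    induction n with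
    | zero =>
      intro u v
      simp only [pow_zero, Matrix.one_apply]
      split_ifs <;> norm_num
    | succ n ih =>
      intro u v
      rw [pow_succ, Matrix.mul_apply]
      exact Finset.sum_nonneg fun w _ => mul_nonneg (ih u w) (hQ0 w v)
  have hstep : ∀ u, h u = (if u ∈ A then 0 else 1) + ∑ v, Q u v * h v := by
    intro u
    by_cases hu : u ∈ A
    · simp [hu, hA u hu, hQ]
    · rw [hh u hu]
      simp only [hu, if_false]
      congr 1
      refine Finset.sum_congr rfl fun v _ => ?_
      by_cases hv : v ∈ A
      · simp [hA v hv]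
      · simp [hQ, hu, hv]
  have hterm : ∀ n, ∑ y ∈ Aᶜ, (Q ^ n) x y = ∑ y, (Q ^ n) x y * (if y ∈ A then 0 else 1) := by
    intro n
    rw [← Finset.sum_compl_add_sum A fun y => (Q ^ n) x y * (if y ∈ A then 0 else 1)]
    rw [Finset.sum_eq_zero (s := A) fun y hy => by simp [hy], add_zero]
    refine Finset.sum_congr rfl fun y hy => ?_
    rw [if_neg (Finset.mem_compl.mp hy), mul_one]
  have hpart : ∀ n, ∑ t ∈ Finset.range n, ∑ y ∈ Aᶜ, (Q ^ t) x y
      = h x - ∑ y, (Q ^ n) x y * h y := by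
    intro n
    induction n with
    | zero => simp [Matrix.one_apply]
    | succ n ih =>
      rw [Finset.sum_range_succ, ih, hterm]
      have e1 : ∑ y, (Q ^ n) x y * h y = ∑ y, (Q ^ n) x y * (if y ∈ A then 0 else 1)
          + ∑ y, (Q ^ (n+1)) x y * h y := by
        have : ∑ y, (Q ^ (n+1)) x y * h y = ∑ y, (Q ^ n) x y * ∑ v, Q y v * h v := by
          simp only [pow_succ, Matrix.mul_apply, Finset.sum_mul, Finset.mul_sum]
          rw [Finset.sum_comm]
          simp only [mul_assoc]
        rw [this, ← Finset.sum_add_distrib]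
        refine Finset.sum_congr rfl fun y _ => ?_
        rw [← mul_add, ← hstep]
      linarith
  have hsum : Summable fun t => ∑ y ∈ Aᶜ, (Q ^ t) x y := by
    refine summable_of_sum_range_le (c := h x)
      (fun t => Finset.sum_nonneg fun y _ => hQn t x y) fun n => ?_
    rw [hpart]
    have := Finset.sum_nonneg (s := Finset.univ) fun y _ => mul_nonneg (hQn n x y) (h0 y)
    linarith
  have hz := hsum.tendsto_atTop_zero
  have hz2 : Tendsto (fun n => ∑ y, (Q ^ n) x y * h y) atTop (𝓝 0) := by
    have hz3 := hz.mul_const (∑ y, h y)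
    rw [zero_mul] at hz3
    refine squeeze_zero (fun n => Finset.sum_nonneg fun y _ => mul_nonneg (hQn n x y) (h0 y))
      (fun n => ?_) hz3
    rw [hterm, Finset.sum_mul]
    refine Finset.sum_le_sum fun y _ => ?_
    by_cases hy : y ∈ A
    · simp [hy, hA y hy]
    · simp only [hy, if_false, mul_one]
      exact mul_le_mul_of_nonneg_left
        (Finset.single_le_sum (f := h) (fun i _ => h0 i) (Finset.mem_univ y)) (hQn n x y)
  have h1 := hsum.hasSum.tendsto_sum_nat
  have h2 : Tendsto (fun n => ∑ t ∈ Finset.range n, ∑ y ∈ Aᶜ, (Q ^ t) x y) atTop (𝓝 (h x)) := by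
    simp only [hpart]
    simpa using hz2.const_sub (h x)
  exact tendsto_nhds_unique h1 h2

theorem Tfun_eq {Ω : Type*} [Fintype Ω] [DecidableEq Ω]
    (P : Matrix Ω Ω ℝ) (π : Ω → ℝ) (α M : ℝ) (x : Ω) (A : Finset Ω)
    (hA : α ≤ ∑ a ∈ A, π a) (hM : hitTime P A x = M)
    (hle : ∀ (x : Ω) (A : Finset Ω), α ≤ ∑ a ∈ A, π a → hitTime P A x ≤ M) :
    Tfun P π α = M := by
  apply IsGreatest.csSup_eq
  refine ⟨⟨x, A, hA, hM.symm⟩, ?_⟩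
  rintro r ⟨y, B, hB, rfl⟩
  exact hle y B hB

theorem hitting_time_ratio_tight (α β : ℝ) (hα : 0 < α) (hαβ : α < β) (hβ : β ≤ 1/2) :
    ∃ (n : ℕ) (P : Matrix (Fin n) (Fin n) ℝ) (π : Fin n → ℝ),
      2 ≤ n ∧ IsTransitionMatrix P ∧ IsIrreducibleChain P ∧ IsStationaryDist P π ∧
      Tfun P π α = Tfun P π β + (α⁻¹ - 1) * Tfun P π (1 - β) ∧
      Tfun P π β + (α⁻¹ - 1) * Tfun P π (1 - β) = Tfun P π β / α := by
  obtain ⟨ε, hε, hεα, hεβ⟩ : ∃ ε : ℝ, 0 < ε ∧ ε < α ∧ α + ε < β := by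
    have h1 : 0 < min α (β - α) := lt_min hα (by linarith)
    have h2 := min_le_left α (β - α)
    have h3 := min_le_right α (β - α)
    exact ⟨min α (β - α) / 2, by linarith, by linarith, by linarith⟩
  obtain ⟨b, hb⟩ : ∃ b, b = 1 - α - ε := ⟨_, rfl⟩
  have hb0 : 1/2 < b := by linarith
  obtain ⟨p, hp⟩ : ∃ p, p = α / b := ⟨_, rfl⟩
  obtain ⟨r, hr⟩ : ∃ r, r = ε / b := ⟨_, rfl⟩
  have hbp : b * p = α := by rw [hp]; field_simp
  have hbr : b * r = ε := by rw [hr]; field_simp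
  have hp0 : 0 < p := by rw [hp]; positivity
  have hr0 : 0 < r := by rw [hr]; positivity
  have hpr : p + r ≤ 1 := by
    rw [hp, hr, ← add_div, div_le_one (by linarith)]; linarith
  obtain ⟨P, hP⟩ : ∃ P : Matrix (Fin 3) (Fin 3) ℝ,
    P = !![1 - p - r, p, r; 1, 0, 0; 1, 0, 0] := ⟨_, rfl⟩
  obtain ⟨π, hπ⟩ : ∃ π : Fin 3 → ℝ, π = ![b, α, ε] := ⟨_, rfl⟩
  have hPnn : ∀ x y, 0 ≤ P x y := by
    intro x y
    fin_cases x <;> fin_cases y <;> simp [hP] <;> linarith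
  have hPs : ∀ x, ∑ y, P x y = 1 := by
    intro x
    fin_cases x <;> simp [hP, Fin.sum_univ_three] <;> ring
  have hmeas : ∀ A : Finset (Fin 3), ∑ a ∈ A, π a =
      (if 0 ∈ A then b else 0) + (if 1 ∈ A then α else 0) + (if 2 ∈ A then ε else 0) := by
    intro A
    have : ∑ a ∈ A, π a = ∑ a, if a ∈ A then π a else 0 := by simp
    rw [this, Fin.sum_univ_three]
    simp [hπ]
  -- sets containing the central state
  have hcen : ∀ A : Finset (Fin 3), 0 ∈ A → ∀ x, hitTime P A x = if x ∈ A then 0 else 1 := by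
    intro A h0 x
    refine hitTime_eq_of_harmonic P A hPnn (fun x => if x ∈ A then 0 else 1) ?_ ?_ ?_ x
    · intro x; split_ifs <;> norm_num
    · intro x hx; simp [hx]
    · intro x hx
      fin_cases x
      · exact absurd h0 hx
      · simp at hx; simp [hP, Fin.sum_univ_three, h0, hx]
      · simp at hx; simp [hP, Fin.sum_univ_three, h0, hx]
  have hcen1 : ∀ A : Finset (Fin 3), 0 ∈ A → ∀ x, hitTime P A x ≤ 1 := by
    intro A h0 x
    rw [hcen A h0 x]; split_ifs <;> norm_num
  have hkey : α⁻¹ - 1 = 1 + (1 - p - r) * (α⁻¹ - 1) + r * α⁻¹ := by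
    have h : p * α⁻¹ = b⁻¹ := by rw [hp]; field_simp
    have h' : b⁻¹ = 1 + p + r := by
      rw [hp, hr]
      have : b ≠ 0 := by linarith
      field_simp
      linarith
    linarith
  have hα1 : 1 < α⁻¹ := by
    rw [one_lt_inv₀ hα]; linarith
  have hs1 : ∀ A : Finset (Fin 3), 0 ∉ A → 1 ∈ A → 2 ∉ A → ∀ x,
      hitTime P A x = ![α⁻¹ - 1, 0, α⁻¹] x := by
    intro A h0 h1 h2 x
    refine hitTime_eq_of_harmonic P A hPnn ![α⁻¹ - 1, 0, α⁻¹] ?_ ?_ ?_ x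
    · intro x; fin_cases x <;> simp <;> linarith
    · intro x hx
      fin_cases x
      · exact absurd hx h0
      · simp
      · exact absurd hx h2
    · intro x hx
      fin_cases x
      · simp [hP, Fin.sum_univ_three]; linarith
      · exact absurd h1 hx
      · simp [hP, Fin.sum_univ_three]
  have hs2 : ∀ A : Finset (Fin 3), 0 ∉ A → 1 ∈ A → 2 ∈ A → ∀ x,
      hitTime P A x = ![(p + r)⁻¹, 0, 0] x := by
    intro A h0 h1 h2 x
    have hpr0 : 0 < p + r := by linarith
    refine hitTime_eq_of_harmonic P A hPnn ![(p + r)⁻¹, 0, 0] ?_ ?_ ?_ x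
    · intro x; fin_cases x <;> simp <;> linarith
    · intro x hx
      fin_cases x
      · exact absurd hx h0
      · simp
      · simp
    · intro x hx
      fin_cases x
      · simp [hP, Fin.sum_univ_three]; field_simp; ring
      · exact absurd h1 hx
      · exact absurd h2 hx
  have hTβ : ∀ γ, α + ε < γ → γ ≤ b → Tfun P π γ = 1 := by
    intro γ hγ1 hγ2
    refine Tfun_eq P π γ 1 1 {0} ?_ ?_ ?_
    · rw [hmeas]; simpa using hγ2
    · rw [hcen _ (by simp)]; simp
    · intro x A hA
      apply hcen1
      by_contra h0
      rw [hmeas, if_neg h0] at hA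
      split_ifs at hA <;> linarith
  have hTα : Tfun P π α = α⁻¹ := by
    refine Tfun_eq P π α _ 2 {1} ?_ ?_ ?_
    · rw [hmeas]; simp
    · rw [hs1 _ (by simp) (by simp) (by simp)]; simp
    · intro x A hA
      by_cases h0 : 0 ∈ A
      · exact (hcen1 A h0 x).trans hα1.le
      by_cases h1 : 1 ∈ A
      · by_cases h2 : 2 ∈ A
        · rw [hs2 A h0 h1 h2]
          have : (p + r)⁻¹ ≤ α⁻¹ := by
            apply inv_anti₀ hα
            nlinarith
          fin_cases x <;> simp <;> linarith
        · rw [hs1 A h0 h1 h2]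
          fin_cases x <;> simp <;> linarith
      · rw [hmeas, if_neg h0, if_neg h1] at hA
        split_ifs at hA <;> linarith
  refine ⟨3, P, π, by norm_num, ⟨hPnn, hPs⟩, ?_, ⟨?_, ?_, ?_⟩, ?_, ?_⟩
  · intro x y
    fin_cases x <;> fin_cases y
    · exact ⟨0, by simp⟩
    · exact ⟨1, by simpa [hP] using hp0⟩
    · exact ⟨1, by simpa [hP] using hr0⟩
    · exact ⟨1, by simp [hP]⟩
    · exact ⟨0, by simp⟩
    · exact ⟨2, by simpa [hP, pow_two, Matrix.mul_apply, Fin.sum_univ_three] using hr0⟩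
    · exact ⟨1, by simp [hP]⟩
    · exact ⟨2, by simpa [hP, pow_two, Matrix.mul_apply, Fin.sum_univ_three] using hp0⟩
    · exact ⟨0, by simp⟩
  · intro x; fin_cases x <;> simp [hπ] <;> linarith
  · simp [hπ, Fin.sum_univ_three]; linarith
  · intro y; fin_cases y <;> simp [hπ, hP, Fin.sum_univ_three] <;> linarith
  · rw [hTα, hTβ β hεβ (by linarith), hTβ (1 - β) (by linarith) (by linarith)]; ring
  · rw [hTβ β hεβ (by linarith), hTβ (1 - β) (by linarith) (by linarith)]; ring
end

section
/- For every β > 1/2 with β < 1, every α ∈ (0, β) and every real M, there exists an irreducible Markov chain on a finite state space (with at least two states) such that T(β) = 0 and T(α) ≥ M; in particular, no inequality of the form T(α) ≤ C·T(β) can hold for β > 1/2. -/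
/-- For every `1/2 < β < 1`, every `α ∈ (0,β)` and every real `M`, there is an
irreducible Markov chain on a finite state space (with at least two states) with `T(β) = 0`
and `T(α) ≥ M`; in particular no inequality `T(α) ≤ C·T(β)` can hold when `β > 1/2`. -/
theorem no_ratio_bound_beyond_half (β α M : ℝ) (hβ1 : 1/2 < β) (hβ2 : β < 1)
    (hα0 : 0 < α) (hαβ : α < β) :
    ∃ (n : ℕ) (P : Matrix (Fin n) (Fin n) ℝ) (π : Fin n → ℝ),
      2 ≤ n ∧ IsTransitionMatrix P ∧ IsIrreducibleChain P ∧ IsStationaryDist P π ∧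
      Tfun P π β = 0 ∧ M ≤ Tfun P π α := by
  obtain ⟨p, hp1, hp2, hp3⟩ : ∃ p : ℝ, 1/2 ≤ p ∧ α ≤ p ∧ p < β :=
    ⟨max (1/2) α, le_max_left _ _, le_max_right _ _, max_lt hβ1 hαβ⟩
  obtain ⟨e, he0, he1, heM⟩ : ∃ e : ℝ, 0 < e ∧ e ≤ 1 ∧ M ≤ e⁻¹ := by
    refine ⟨(|M| + 1)⁻¹, by positivity, inv_le_one_of_one_le₀ (by linarith [abs_nonneg M]), ?_⟩
    rw [inv_inv]
    linarith [le_abs_self M]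
  obtain ⟨f, hf0, hf1, hf⟩ : ∃ f : ℝ, 0 < f ∧ f ≤ 1 ∧ p * f = (1 - p) * e := by
    have hp : 0 < p := by linarith
    refine ⟨(1 - p) * e / p, div_pos (mul_pos (by linarith) he0) hp, ?_, by field_simp⟩
    rw [div_le_one hp]
    nlinarith
  refine ⟨2, !![1 - f, f; e, 1 - e], ![p, 1 - p], le_refl _, ⟨?_, ?_⟩, ?_, ⟨?_, ?_, ?_⟩, ?_, ?_⟩
  · intro x y
    fin_cases x <;> fin_cases y <;> simp <;> linarith
  · intro x
    fin_cases x <;> simp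
  · intro x y
    fin_cases x <;> fin_cases y
    · exact ⟨0, by simp⟩
    · exact ⟨1, by simpa using hf0⟩
    · exact ⟨1, by simpa using he0⟩
    · exact ⟨0, by simp⟩
  · intro x
    fin_cases x <;> simp <;> linarith
  · simp
  · intro y
    fin_cases y <;> simp <;> linarith
  · have key : {r | ∃ (x : Fin 2) (A : Finset (Fin 2)), β ≤ ∑ a ∈ A, (![p, 1 - p] : Fin 2 → ℝ) a ∧
        r = hitTime !![1 - f, f; e, 1 - e] A x} = {0} := by
      ext r
      simp only [Set.mem_setOf_eq, Set.mem_singleton_iff]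
      constructor
      · rintro ⟨x, A, hA, rfl⟩
        have hu : A = Finset.univ := by
          by_contra hne
          have h01 : 0 ∉ A ∨ 1 ∉ A := by
            by_contra! h
            apply hne
            ext a
            fin_cases a <;> simp [h.1, h.2]
          have hsum : ∑ a ∈ A, (![p, 1 - p] : Fin 2 → ℝ) a
              = (if (0 : Fin 2) ∈ A then p else 0) + (if (1 : Fin 2) ∈ A then 1 - p else 0) := by
            have h2 := Finset.sum_ite_mem Finset.univ A (![p, 1 - p] : Fin 2 → ℝ)
            rw [Finset.univ_inter] at h2
            rw [← h2, Fin.sum_univ_two]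
            simp
          rw [hsum] at hA
          rcases h01 with h | h
          · simp only [h, if_false] at hA
            split_ifs at hA <;> linarith
          · simp only [h, if_false] at hA
            split_ifs at hA <;> linarith
        subst hu
        simp [hitTime]
      · rintro rfl
        refine ⟨0, Finset.univ, ?_, by simp [hitTime]⟩
        simp
        linarith
    unfold Tfun
    rw [key, csSup_singleton]
  · have hval : hitTime !![1 - f, f; e, 1 - e] {0} (1 : Fin 2) = e⁻¹ := by
      have hQ : (Matrix.of fun u v : Fin 2 => if u ∈ ({0} : Finset (Fin 2)) ∨ v ∈ ({0} : Finset (Fin 2))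
          then (0:ℝ) else !![1 - f, f; e, 1 - e] u v) = Matrix.diagonal ![0, 1 - e] := by
        ext u v
        fin_cases u <;> fin_cases v <;> simp
      have hc : ({0} : Finset (Fin 2))ᶜ = {1} := by decide
      unfold hitTime
      rw [hQ, hc]
      simp only [Matrix.diagonal_pow, Finset.sum_singleton, Matrix.diagonal_apply_eq, Pi.pow_apply]
      have := tsum_geometric_of_lt_one (r := 1 - e) (by linarith) (by linarith)
      simpa using this
    refine heM.trans ?_
    rw [← hval]
    apply le_csSup
    · apply Set.Finite.bddAbove
      apply (Set.finite_range (fun q : Fin 2 × Finset (Fin 2) =>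
        hitTime !![1 - f, f; e, 1 - e] q.2 q.1)).subset
      rintro r ⟨x, A, _, rfl⟩
      exact ⟨(x, A), rfl⟩
    · exact ⟨1, {0}, by simpa using hp2, rfl⟩
end

section
/- Let 1/2 < γ < 1 and let N be a real number with N ≥ 1/(1−γ), and consider the Markov chain on the two-state space {1,2} with transition matrix P given by rows (1 − 1/(γN), 1/(γN)) and (1/((1−γ)N), 1 − 1/((1−γ)N)). Then this chain is irreducible with stationary distribution π = (γ, 1−γ); moreover T(β) = 0 for every β ∈ (γ, 1), and T(α) ≥ (1−γ)N for every α ∈ (0, γ]. -/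
/-- Powers of a 2x2 matrix supported at the lower right entry. -/
theorem corner_pow (q : ℝ) (t : ℕ) :
    ((!![0, 0; 0, q] : Matrix (Fin 2) (Fin 2) ℝ) ^ t) 1 1 = q ^ t := by
  induction t with
  | zero => simp
  | succ k ih =>
    rw [pow_succ, Matrix.mul_apply, Fin.sum_univ_two, ih]
    simp [pow_succ]

/-- Expected hitting time of state `0` from state `1`. -/
theorem hitTime_corner (a b c q : ℝ) (h0 : 0 ≤ q) (h1 : q < 1) :
    hitTime !![a, b; c, q] ({0} : Finset (Fin 2)) 1 = (1 - q)⁻¹ := by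
  have hQ : (Matrix.of fun u v : Fin 2 => if u ∈ ({0} : Finset (Fin 2)) ∨ v ∈ ({0} : Finset (Fin 2))
      then (0:ℝ) else (!![a, b; c, q] : Matrix (Fin 2) (Fin 2) ℝ) u v) = !![0, 0; 0, q] := by
    ext u v
    fin_cases u <;> fin_cases v <;> simp
  have hc : (({0} : Finset (Fin 2))ᶜ) = {1} := by decide
  unfold hitTime
  rw [hQ, hc]
  simp only [Finset.sum_singleton, corner_pow]
  exact tsum_geometric_of_lt_one h0 h1

/-- For `1/2 < γ < 1` and a real `N ≥ 1/(1−γ)`, the two-state chain with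
transition matrix rows `(1 − 1/(γN), 1/(γN))` and `(1/((1−γ)N), 1 − 1/((1−γ)N))` is
irreducible with stationary distribution `(γ, 1−γ)`; moreover `T(β) = 0` for every
`β ∈ (γ, 1)` and `T(α) ≥ (1−γ)N` for every `α ∈ (0, γ]`. -/
theorem two_state_example (γ N : ℝ) (hγ1 : 1/2 < γ) (hγ2 : γ < 1) (hN : 1/(1-γ) ≤ N) :
    IsTransitionMatrix !![1 - 1/(γ*N), 1/(γ*N); 1/((1-γ)*N), 1 - 1/((1-γ)*N)] ∧
    IsIrreducibleChain !![1 - 1/(γ*N), 1/(γ*N); 1/((1-γ)*N), 1 - 1/((1-γ)*N)] ∧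
    IsStationaryDist !![1 - 1/(γ*N), 1/(γ*N); 1/((1-γ)*N), 1 - 1/((1-γ)*N)] ![γ, 1-γ] ∧
    (∀ β : ℝ, γ < β → β < 1 →
      Tfun !![1 - 1/(γ*N), 1/(γ*N); 1/((1-γ)*N), 1 - 1/((1-γ)*N)] ![γ, 1-γ] β = 0) ∧
    (∀ α : ℝ, 0 < α → α ≤ γ →
      (1-γ) * N ≤ Tfun !![1 - 1/(γ*N), 1/(γ*N); 1/((1-γ)*N), 1 - 1/((1-γ)*N)] ![γ, 1-γ] α) := by
  have hg : 0 < 1 - γ := by linarith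
  have hg0 : 0 < γ := by linarith
  have hNp : 0 < N := lt_of_lt_of_le (by positivity) hN
  have hM : 1 ≤ (1 - γ) * N := by
    rw [div_le_iff₀ hg] at hN
    linarith
  have hM2 : 1 ≤ γ * N := by nlinarith
  have ha : 0 < 1 / (γ * N) := by positivity
  have hb : 0 < 1 / ((1 - γ) * N) := by positivity
  have ha1 : 1 / (γ * N) ≤ 1 := by rw [div_le_one (by linarith)]; exact hM2
  have hb1 : 1 / ((1 - γ) * N) ≤ 1 := by rw [div_le_one (by linarith)]; exact hM
  refine ⟨⟨?_, ?_⟩, ?_, ⟨?_, ?_, ?_⟩, ?_, ?_⟩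
  · rw [Fin.forall_fin_two, Fin.forall_fin_two, Fin.forall_fin_two]
    refine ⟨⟨?_, ?_⟩, ?_, ?_⟩
    · show 0 ≤ 1 - 1 / (γ * N)
      linarith
    · exact ha.le
    · exact hb.le
    · show 0 ≤ 1 - 1 / ((1 - γ) * N)
      linarith
  · rw [Fin.forall_fin_two, Fin.sum_univ_two, Fin.sum_univ_two]
    constructor
    · show 1 - 1 / (γ * N) + 1 / (γ * N) = 1
      ring
    · show 1 / ((1 - γ) * N) + (1 - 1 / ((1 - γ) * N)) = 1
      ring
  · unfold IsIrreducibleChain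
    rw [Fin.forall_fin_two, Fin.forall_fin_two, Fin.forall_fin_two]
    refine ⟨⟨⟨0, ?_⟩, ⟨1, ?_⟩⟩, ⟨1, ?_⟩, ⟨0, ?_⟩⟩
    · simp
    · rw [pow_one]; exact ha
    · rw [pow_one]; exact hb
    · simp
  · rw [Fin.forall_fin_two]
    exact ⟨hg0.le, hg.le⟩
  · rw [Fin.sum_univ_two]
    show γ + (1 - γ) = 1
    ring
  · rw [Fin.forall_fin_two, Fin.sum_univ_two, Fin.sum_univ_two]
    constructor
    · show γ * (1 - 1 / (γ * N)) + (1 - γ) * (1 / ((1 - γ) * N)) = γ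
      field_simp
      ring
    · show γ * (1 / (γ * N)) + (1 - γ) * (1 - 1 / ((1 - γ) * N)) = 1 - γ
      field_simp
      ring
  · intro β hβ hβ1
    unfold Tfun
    have huniv : ∀ A : Finset (Fin 2), β ≤ ∑ a ∈ A, (![γ, 1 - γ] : Fin 2 → ℝ) a →
        A = Finset.univ := by
      intro A hA
      have hcases : A = ∅ ∨ A = {0} ∨ A = {1} ∨ A = Finset.univ := by
        clear hA
        revert A
        decide
      rcases hcases with h | h | h | h
      · subst h; simp at hA; linarith
      · subst h; simp at hA; linarith
      · subst h; simp at hA; linarith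
      · exact h
    have hset : {r | ∃ (x : Fin 2) (A : Finset (Fin 2)),
        β ≤ ∑ a ∈ A, (![γ, 1 - γ] : Fin 2 → ℝ) a ∧
        r = hitTime !![1 - 1/(γ*N), 1/(γ*N); 1/((1-γ)*N), 1 - 1/((1-γ)*N)] A x} = {0} := by
      ext r
      simp only [Set.mem_setOf_eq, Set.mem_singleton_iff]
      constructor
      · rintro ⟨x, A, hA, rfl⟩
        rw [huniv A hA]
        simp [hitTime]
      · rintro rfl
        refine ⟨0, Finset.univ, ?_, ?_⟩
        · simp [Fin.sum_univ_two]; linarith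
        · simp [hitTime]
    rw [hset, csSup_singleton]
  · intro α _ hα
    unfold Tfun
    apply le_csSup
    · apply Set.Finite.bddAbove
      refine (Set.finite_range fun p : Fin 2 × Finset (Fin 2) =>
        hitTime !![1 - 1/(γ*N), 1/(γ*N); 1/((1-γ)*N), 1 - 1/((1-γ)*N)] p.2 p.1).subset ?_
      rintro r ⟨x, A, _, rfl⟩
      exact ⟨(x, A), rfl⟩
    · refine ⟨1, {0}, ?_, ?_⟩
      · simpa using hα
      · rw [hitTime_corner _ _ _ _ (by linarith) (by linarith)]
        simp
end

section
/- Consider an irreducible Markov chain on a finite state space Ω, write T = T(1/50), and suppose T > 0 and that there exist A ⊆ Ω with π(A) ≥ 1/100 and x ∈ Ω with E_x[τ_A] = 99.9·T. Then π({y ∈ Ω : E_y[τ_A] ≤ 99·T}) ≥ 0.98, and moreover π({y ∈ Ω : 98.9·T ≤ E_y[τ_A] ≤ 99·T}) ≥ 0.96. -/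
section Helpers
variable {Ω : Type*} [Fintype Ω] [DecidableEq Ω]

/-- Minimum principle. -/
lemma aux_min_principle (P : Matrix Ω Ω ℝ) (hP : IsTransitionMatrix P)
    (hirr : IsIrreducibleChain P) (S : Finset Ω) (hS : S.Nonempty) (w : Ω → ℝ)
    (hw : ∀ y, y ∉ S → ∑ v, P y v * w v ≤ w y) (hwS : ∀ y ∈ S, 0 ≤ w y) :
    ∀ y, 0 ≤ w y := by
  obtain ⟨s, hs⟩ := hS
  obtain ⟨y0, -, hy0⟩ := Finset.exists_min_image Finset.univ w ⟨s, Finset.mem_univ s⟩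
  by_contra! hcon
  obtain ⟨y1, hy1⟩ := hcon
  have hm : w y0 < 0 := lt_of_le_of_lt (hy0 y1 (Finset.mem_univ _)) hy1
  have hPn : ∀ n : ℕ, ∀ a b, 0 ≤ (P ^ n) a b := by
    intro n
    induction n with
    | zero =>
      intro a b
      rw [pow_zero, Matrix.one_apply]
      split_ifs <;> norm_num
    | succ k ih =>
      intro a b
      rw [pow_succ, Matrix.mul_apply]
      exact Finset.sum_nonneg fun v _ => mul_nonneg (ih a v) (hP.1 v b)
  have key : ∀ n : ℕ, ∀ z, 0 < (P ^ n) y0 z → w z = w y0 := by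
    intro n
    induction n with
    | zero =>
      intro z hz
      rw [pow_zero, Matrix.one_apply] at hz
      split_ifs at hz with h
      · rw [h]
      · exact absurd hz (lt_irrefl _)
    | succ k ih =>
      intro z hz
      rw [pow_succ, Matrix.mul_apply] at hz
      obtain ⟨v, -, hv⟩ := Finset.exists_lt_of_sum_lt
        (s := Finset.univ) (f := fun _ : Ω => (0 : ℝ)) (by simpa using hz)
      have h1 : 0 < (P ^ k) y0 v := by
        rcases (hPn k y0 v).lt_or_eq with h | h
        · exact h
        · rw [← h] at hv; simp at hv
      have h2 : 0 < P v z := by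
        rcases (hP.1 v z).lt_or_eq with h | h
        · exact h
        · rw [← h] at hv; simp at hv
      have hwv := ih v h1
      have hvS : v ∉ S := fun h => by have := hwS v h; linarith
      have h3 := hw v hvS
      have h4 : ∑ u, P v u * (w u - w y0) = ∑ u, P v u * w u - w y0 := by
        simp only [mul_sub, Finset.sum_sub_distrib, ← Finset.sum_mul, hP.2 v, one_mul]
      have h5 : P v z * (w z - w y0) ≤ ∑ u, P v u * (w u - w y0) :=
        Finset.single_le_sum (f := fun u => P v u * (w u - w y0))
          (fun u _ => mul_nonneg (hP.1 v u) (sub_nonneg.2 (hy0 u (Finset.mem_univ _))))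
          (Finset.mem_univ z)
      have h6 := hy0 z (Finset.mem_univ _)
      have h7 : P v z * (w z - w y0) ≤ 0 := by linarith
      by_contra hne
      have h8 : 0 < w z - w y0 := sub_pos.2 (lt_of_le_of_ne h6 (Ne.symm hne))
      have := mul_pos h2 h8
      linarith
  obtain ⟨n, hn⟩ := hirr y0 s
  have h9 := key n s hn
  have h10 := hwS s hs
  linarith

/-- Existence of a nonnegative solution of the hitting time equations. -/
lemma aux_exists_sol (P : Matrix Ω Ω ℝ) (hP : IsTransitionMatrix P)
    (hirr : IsIrreducibleChain P) (S : Finset Ω) (hS : S.Nonempty) :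
    ∃ w : Ω → ℝ, (∀ y, 0 ≤ w y) ∧ ∀ y, y ∉ S → w y = 1 + ∑ v, P y v * w v := by
  let L : (Ω → ℝ) →ₗ[ℝ] (Ω → ℝ) :=
    { toFun := fun f y => if y ∈ S then f y else f y - ∑ v, P y v * f v
      map_add' := by
        intro f g
        ext y
        by_cases h : y ∈ S
        · simp [h]
        · simp [h, mul_add, Finset.sum_add_distrib]; ring
      map_smul' := by
        intro c f
        ext y
        by_cases h : y ∈ S
        · simp [h]
        · simp [h, mul_sub, Finset.mul_sum, mul_left_comm] }
  have hL : ∀ f y, L f y = if y ∈ S then f y else f y - ∑ v, P y v * f v := fun _ _ => rfl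
  have hinj : Function.Injective L := by
    rw [injective_iff_map_eq_zero]
    intro f hf
    have hfy : ∀ y, (if y ∈ S then f y else f y - ∑ v, P y v * f v) = 0 := by
      intro y; rw [← hL, hf]; rfl
    have h1 := aux_min_principle P hP hirr S hS f
      (fun y hy => by have := hfy y; rw [if_neg hy] at this; linarith)
      (fun y hy => by have := hfy y; rw [if_pos hy] at this; linarith)
    have h2 := aux_min_principle P hP hirr S hS (fun y => - f y)
      (fun y hy => by
        have := hfy y; rw [if_neg hy] at this
        simp only [mul_neg, Finset.sum_neg_distrib]; linarith)
      (fun y hy => by have := hfy y; rw [if_pos hy] at this; linarith)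
    ext y
    have a := h1 y
    have b := h2 y
    simp only [Pi.zero_apply]
    linarith
  obtain ⟨w, hw⟩ := LinearMap.surjective_of_injective hinj (fun y => if y ∈ S then 0 else 1)
  have hwy : ∀ y, (if y ∈ S then w y else w y - ∑ v, P y v * w v) = if y ∈ S then 0 else 1 := by
    intro y; rw [← hL, hw]
  refine ⟨w, ?_, ?_⟩
  · apply aux_min_principle P hP hirr S hS w
    · intro y hy
      have := hwy y; rw [if_neg hy, if_neg hy] at this; linarith
    · intro y hy
      have := hwy y; rw [if_pos hy, if_pos hy] at this; linarith
  · intro y hy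
    have := hwy y; rw [if_neg hy, if_neg hy] at this; linarith

/-- survival probability -/
noncomputable def auxSurv (P : Matrix Ω Ω ℝ) (A : Finset Ω) (t : ℕ) (x : Ω) : ℝ :=
  ∑ y ∈ Aᶜ, (((Matrix.of fun u v => if u ∈ A ∨ v ∈ A then (0:ℝ) else P u v)) ^ t) x y

lemma auxSurv_zero (P : Matrix Ω Ω ℝ) (A : Finset Ω) (x : Ω) :
    auxSurv P A 0 x = if x ∈ A then 0 else 1 := by
  unfold auxSurv
  simp only [pow_zero, Matrix.one_apply, Finset.sum_ite_eq, Finset.mem_compl]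
  by_cases h : x ∈ A <;> simp [h]

lemma auxSurv_succ (P : Matrix Ω Ω ℝ) (A : Finset Ω) (t : ℕ) (x : Ω) :
    auxSurv P A (t+1) x =
      ∑ v, (if x ∈ A ∨ v ∈ A then (0:ℝ) else P x v) * auxSurv P A t v := by
  unfold auxSurv
  simp only [pow_succ', Matrix.mul_apply, Finset.mul_sum]
  rw [Finset.sum_comm]
  rfl

lemma auxSurv_mem (P : Matrix Ω Ω ℝ) (A : Finset Ω) (t : ℕ) (x : Ω) (hx : x ∈ A) :
    auxSurv P A t x = 0 := by
  cases t with
  | zero => rw [auxSurv_zero, if_pos hx]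
  | succ t => rw [auxSurv_succ]; simp [hx]

lemma auxSurv_succ' (P : Matrix Ω Ω ℝ) (A : Finset Ω) (t : ℕ) (x : Ω) (hx : x ∉ A) :
    auxSurv P A (t+1) x = ∑ v, P x v * auxSurv P A t v := by
  rw [auxSurv_succ]
  refine Finset.sum_congr rfl fun v _ => ?_
  by_cases h : v ∈ A
  · rw [auxSurv_mem P A t v h]; simp
  · simp [h, hx]

lemma auxSurv_nonneg (P : Matrix Ω Ω ℝ) (hP : IsTransitionMatrix P) (A : Finset Ω) (t : ℕ) :
    ∀ x, 0 ≤ auxSurv P A t x := by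
  induction t with
  | zero => intro x; rw [auxSurv_zero]; split_ifs <;> norm_num
  | succ t ih =>
    intro x
    by_cases hx : x ∈ A
    · rw [auxSurv_mem P A _ x hx]
    · rw [auxSurv_succ' P A t x hx]
      exact Finset.sum_nonneg fun v _ => mul_nonneg (hP.1 x v) (ih v)

/-- partial sums -/
noncomputable def auxPart (P : Matrix Ω Ω ℝ) (A : Finset Ω) (n : ℕ) (x : Ω) : ℝ :=
  ∑ t ∈ Finset.range n, auxSurv P A t x

lemma auxPart_succ (P : Matrix Ω Ω ℝ) (A : Finset Ω) (n : ℕ) (x : Ω) (hx : x ∉ A) :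
    auxPart P A (n+1) x = 1 + ∑ v, P x v * auxPart P A n v := by
  unfold auxPart
  rw [Finset.sum_range_succ', auxSurv_zero, if_neg hx, add_comm]
  congr 1
  simp only [Finset.mul_sum]
  rw [Finset.sum_comm]
  exact Finset.sum_congr rfl fun t _ => auxSurv_succ' P A t x hx

lemma auxPart_mem (P : Matrix Ω Ω ℝ) (A : Finset Ω) (n : ℕ) (x : Ω) (hx : x ∈ A) :
    auxPart P A n x = 0 :=
  Finset.sum_eq_zero fun t _ => auxSurv_mem P A t x hx

lemma auxPart_le (P : Matrix Ω Ω ℝ) (hP : IsTransitionMatrix P) (A : Finset Ω) (C : Set Ω)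
    (w : Ω → ℝ) (hw0 : ∀ y, 0 ≤ w y)
    (hw : ∀ y, y ∉ A → y ∉ C → 1 + ∑ v, P y v * w v ≤ w y)
    (hC : ∀ y ∈ C, ∀ n, auxPart P A n y ≤ w y) (n : ℕ) :
    ∀ y, auxPart P A n y ≤ w y := by
  induction n with
  | zero => intro y; simpa [auxPart] using hw0 y
  | succ n ih =>
    intro y
    by_cases hy : y ∈ A
    · rw [auxPart_mem P A _ y hy]; exact hw0 y
    by_cases hy' : y ∈ C
    · exact hC y hy' _
    rw [auxPart_succ P A n y hy]
    refine le_trans ?_ (hw y hy hy')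
    gcongr with v _
    · exact hP.1 y v
    · exact ih v

lemma aux_summable (P : Matrix Ω Ω ℝ) (hP : IsTransitionMatrix P)
    (hirr : IsIrreducibleChain P) (A : Finset Ω) (hA : A.Nonempty) (x : Ω) :
    Summable fun t => auxSurv P A t x := by
  obtain ⟨w, hw0, hw⟩ := aux_exists_sol P hP hirr A hA
  exact summable_of_sum_range_le (c := w x) (fun t => auxSurv_nonneg P hP A t x)
    (fun n => auxPart_le P hP A ∅ w hw0 (fun y hy _ => (hw y hy).ge)
      (fun y hy => absurd hy (Set.notMem_empty y)) n x)

lemma aux_tendsto (P : Matrix Ω Ω ℝ) (hP : IsTransitionMatrix P)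
    (hirr : IsIrreducibleChain P) (A : Finset Ω) (hA : A.Nonempty) (x : Ω) :
    Filter.Tendsto (fun n => auxPart P A n x) Filter.atTop (nhds (hitTime P A x)) :=
  (aux_summable P hP hirr A hA x).hasSum.tendsto_sum_nat

lemma auxPart_le_hit (P : Matrix Ω Ω ℝ) (hP : IsTransitionMatrix P)
    (hirr : IsIrreducibleChain P) (A : Finset Ω) (hA : A.Nonempty) (x : Ω) (n : ℕ) :
    auxPart P A n x ≤ hitTime P A x :=
  (aux_summable P hP hirr A hA x).sum_le_tsum _ (fun t _ => auxSurv_nonneg P hP A t x)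

lemma hit_nonneg (P : Matrix Ω Ω ℝ) (hP : IsTransitionMatrix P) (A : Finset Ω) (x : Ω) :
    0 ≤ hitTime P A x :=
  tsum_nonneg fun t => auxSurv_nonneg P hP A t x

lemma hit_mem (P : Matrix Ω Ω ℝ) (A : Finset Ω) (x : Ω) (hx : x ∈ A) :
    hitTime P A x = 0 := by
  have : hitTime P A x = ∑' t, auxSurv P A t x := rfl
  rw [this]
  simp [auxSurv_mem P A _ x hx]

lemma hit_eq (P : Matrix Ω Ω ℝ) (hP : IsTransitionMatrix P)
    (hirr : IsIrreducibleChain P) (A : Finset Ω) (hA : A.Nonempty) (x : Ω) (hx : x ∉ A) :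
    hitTime P A x = 1 + ∑ v, P x v * hitTime P A v := by
  have h1 := (aux_tendsto P hP hirr A hA x).comp (Filter.tendsto_add_atTop_nat 1)
  have h2 : Filter.Tendsto (fun n => 1 + ∑ v, P x v * auxPart P A n v) Filter.atTop
      (nhds (1 + ∑ v, P x v * hitTime P A v)) :=
    tendsto_const_nhds.add (tendsto_finsetSum _ fun v _ =>
      tendsto_const_nhds.mul (aux_tendsto P hP hirr A hA v))
  refine tendsto_nhds_unique h1 (h2.congr fun n => ?_)
  exact (auxPart_succ P A n x hx).symm

/-- Triangle-type inequality. -/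
lemma hit_triangle (P : Matrix Ω Ω ℝ) (hP : IsTransitionMatrix P)
    (hirr : IsIrreducibleChain P) (A C : Finset Ω) (hA : A.Nonempty) (hC : C.Nonempty)
    (M : ℝ) (hM0 : 0 ≤ M) (hM : ∀ y ∈ C, hitTime P A y ≤ M) (x : Ω) :
    hitTime P A x ≤ hitTime P C x + M := by
  refine le_of_tendsto' (aux_tendsto P hP hirr A hA x) fun n => ?_
  refine auxPart_le P hP A (C : Set Ω) (fun y => hitTime P C y + M)
    (fun y => add_nonneg (hit_nonneg P hP C y) hM0) ?_ ?_ n x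
  · intro y _ hy
    have h := hit_eq P hP hirr C hC y (by simpa using hy)
    simp only [mul_add, Finset.sum_add_distrib, ← Finset.sum_mul, hP.2 y, one_mul]
    linarith
  · intro y hy n
    have h1 := auxPart_le_hit P hP hirr A hA y n
    have h2 := hM y (by simpa using hy)
    have h3 := hit_nonneg P hP C y
    show _ ≤ hitTime P C y + M
    linarith

/-- Stationarity. -/
lemma aux_stat (P : Matrix Ω Ω ℝ) (π : Ω → ℝ) (hπ : IsStationaryDist P π) (f : Ω → ℝ) :
    ∑ y, π y * (f y - ∑ v, P y v * f v) = 0 := by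
  simp only [mul_sub, Finset.sum_sub_distrib, Finset.mul_sum]
  rw [Finset.sum_comm (f := fun y v => π y * (P y v * f v)), sub_eq_zero]
  refine Finset.sum_congr rfl fun v _ => ?_
  rw [← hπ.2.2 v, Finset.sum_mul]
  exact Finset.sum_congr rfl fun y _ => by ring

/-- The key inequality `π(A) ≤ s`. -/
lemma aux_key (P : Matrix Ω Ω ℝ) (π : Ω → ℝ) (hP : IsTransitionMatrix P)
    (hirr : IsIrreducibleChain P) (hπ : IsStationaryDist P π) (A B : Finset Ω)
    (hA : A.Nonempty) (hB : B.Nonempty) (T s : ℝ) (hs0 : 0 ≤ s) (hs1 : s ≤ 1)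
    (h1 : ∀ y ∈ A, hitTime P B y ≤ T) (h2 : ∀ y ∈ B, (1 - s) * T ≤ s * hitTime P A y)
    (hd : Disjoint A B) :
    ∑ a ∈ A, π a ≤ s := by
  set u : Ω → ℝ := fun y => (1 - s) * hitTime P B y with hu
  set v : Ω → ℝ := fun y => (1 - s) * T - s * hitTime P A y with hv
  set f : Ω → ℝ := fun y => min (u y) (v y) with hf
  have hPu : ∀ y, ∑ z, P y z * f z ≤ (1 - s) * ∑ z, P y z * hitTime P B z := by
    intro y
    rw [Finset.mul_sum]
    refine Finset.sum_le_sum fun z _ => ?_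
    have := mul_le_mul_of_nonneg_left (min_le_left (u z) (v z)) (hP.1 y z)
    simp only [hf, hu] at this ⊢
    linarith
  have hPv : ∀ y, ∑ z, P y z * f z ≤ (1 - s) * T - s * ∑ z, P y z * hitTime P A z := by
    intro y
    have h : (1 - s) * T - s * ∑ z, P y z * hitTime P A z = ∑ z, P y z * v z := by
      simp only [hv, mul_sub, Finset.sum_sub_distrib, ← Finset.sum_mul, hP.2 y, one_mul,
        Finset.mul_sum]
      congr 1
      exact Finset.sum_congr rfl fun z _ => by ring
    rw [h]
    exact Finset.sum_le_sum fun z _ =>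
      mul_le_mul_of_nonneg_left (min_le_right (u z) (v z)) (hP.1 y z)
  have hpt : ∀ y, (if y ∈ A then (1:ℝ) else 0) - s ≤ f y - ∑ z, P y z * f z := by
    intro y
    by_cases hyA : y ∈ A
    · have hyB : y ∉ B := Finset.disjoint_left.1 hd hyA
      have e := hit_eq P hP hirr B hB y hyB
      have e2 : f y = u y := by
        apply min_eq_left
        simp only [hu, hv, hit_mem P A y hyA]
        have := mul_le_mul_of_nonneg_left (h1 y hyA) (sub_nonneg.2 hs1)
        linarith
      rw [if_pos hyA, e2]
      have := hPu y
      simp only [hu]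
      rw [e]
      linarith
    · have e := hit_eq P hP hirr A hA y hyA
      rw [if_neg hyA]
      have h3 : f y = v y → 0 - s ≤ f y - ∑ z, P y z * f z := by
        intro h
        rw [h]
        have := hPv y
        simp only [hv]
        rw [e]
        linarith
      by_cases hyB : y ∈ B
      · apply h3
        apply min_eq_right
        simp only [hu, hv, hit_mem P B y hyB]
        have := h2 y hyB
        linarith
      · rcases min_choice (u y) (v y) with h | h
        · have e' := hit_eq P hP hirr B hB y hyB
          have h' : f y = u y := h
          rw [h']
          have := hPu y
          simp only [hu]
          rw [e']
          linarith
        · exact h3 h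
  have h0 := aux_stat P π hπ f
  have h4 : ∑ y, π y * ((if y ∈ A then (1:ℝ) else 0) - s) ≤ 0 := by
    refine le_trans ?_ h0.le
    exact Finset.sum_le_sum fun y _ => mul_le_mul_of_nonneg_left (hpt y) (hπ.1 y)
  have h5 : ∑ y, π y * ((if y ∈ A then (1:ℝ) else 0) - s) = ∑ a ∈ A, π a - s := by
    simp only [mul_sub, Finset.sum_sub_distrib, ← Finset.sum_mul, hπ.2.1, one_mul]
    simp
  linarith

lemma aux_le_T (P : Matrix Ω Ω ℝ) (π : Ω → ℝ) (α : ℝ) (A : Finset Ω) (x : Ω)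
    (h : α ≤ ∑ a ∈ A, π a) : hitTime P A x ≤ Tfun P π α := by
  refine le_csSup ?_ ⟨x, A, h, rfl⟩
  refine Set.Finite.bddAbove ?_
  refine (Set.finite_range fun p : Ω × Finset Ω => hitTime P p.2 p.1).subset ?_
  rintro r ⟨x, A, -, rfl⟩
  exact ⟨(x, A), rfl⟩

lemma aux_nonempty (π : Ω → ℝ) (A : Finset Ω) (α : ℝ) (hα : 0 < α)
    (h : α ≤ ∑ a ∈ A, π a) : A.Nonempty := by
  rw [Finset.nonempty_iff_ne_empty]
  rintro rfl
  simp at h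
  linarith

end Helpers

/-- For an irreducible Markov chain on a finite state space, write
`T = T(1/50)` and suppose `T > 0` and there are `A ⊆ Ω` with `π(A) ≥ 1/100` and `x ∈ Ω` with
`E_x[τ_A] = 99.9·T`.  Then `π({y : E_y[τ_A] ≤ 99T}) ≥ 0.98` and
`π({y : 98.9·T ≤ E_y[τ_A] ≤ 99T}) ≥ 0.96`. -/
theorem measure_of_moderate_states {Ω : Type*} [Fintype Ω] [DecidableEq Ω] [Nonempty Ω]
    (P : Matrix Ω Ω ℝ) (π : Ω → ℝ)
    (hP : IsTransitionMatrix P) (hirr : IsIrreducibleChain P) (hπ : IsStationaryDist P π)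
    (T : ℝ) (hT : T = Tfun P π (1/50)) (hTpos : 0 < T)
    (A : Finset Ω) (hA : 1/100 ≤ ∑ a ∈ A, π a)
    (x : Ω) (hx : hitTime P A x = (999/10) * T) :
    (98/100 : ℝ) ≤ ∑ y, Set.indicator {y | hitTime P A y ≤ 99 * T} π y ∧
    (96/100 : ℝ) ≤
      ∑ y, Set.indicator {y | (989/10) * T ≤ hitTime P A y ∧ hitTime P A y ≤ 99 * T} π y := by
  classical
  have hAne : A.Nonempty := aux_nonempty π A (1/100) (by norm_num) hA
  set B : Finset Ω := Finset.univ.filter fun y => 99 * T < hitTime P A y with hBdef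
  set C : Finset Ω := Finset.univ.filter fun y => hitTime P A y < (989/10) * T with hCdef
  have hB : ∑ b ∈ B, π b < 1/50 := by
    by_contra! hcon
    have hBne : B.Nonempty := aux_nonempty π B (1/50) (by norm_num) hcon
    obtain ⟨b, hb, hbmin⟩ := Finset.exists_min_image B (fun y => hitTime P A y) hBne
    have hd : 99 * T < hitTime P A b := by simpa [hBdef] using hb
    set d := hitTime P A b with hddef
    have hpos : 0 < T + d := by linarith
    have hne : T + d ≠ 0 := hpos.ne'
    have hk := aux_key P π hP hirr hπ A B hAne hBne T (T / (T + d))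
      (by positivity) (by rw [div_le_one hpos]; linarith)
      (fun y _ => hT ▸ aux_le_T P π (1/50) B y hcon)
      (fun y hy => by
        have e : (1 - T / (T + d)) * T = T / (T + d) * d := by field_simp; ring
        rw [e]
        exact mul_le_mul_of_nonneg_left (hbmin y hy) (by positivity))
      (by
        rw [Finset.disjoint_left]
        intro a ha hab
        have : 99 * T < hitTime P A a := by simpa [hBdef] using hab
        rw [hit_mem P A a ha] at this
        linarith)
    have : T / (T + d) < 1/100 := by
      rw [div_lt_iff₀ hpos]; linarith
    linarith
  have hC : ∑ c ∈ C, π c < 1/50 := by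
    by_contra! hcon
    have hCne : C.Nonempty := aux_nonempty π C (1/50) (by norm_num) hcon
    obtain ⟨c, hc, hcmax⟩ := Finset.exists_max_image C (fun y => hitTime P A y) hCne
    have h1 : hitTime P A c < (989/10) * T := by simpa [hCdef] using hc
    have h2 := hit_triangle P hP hirr A C hAne hCne (hitTime P A c) (hit_nonneg P hP A c)
      hcmax x
    have h3 : hitTime P C x ≤ T := hT ▸ aux_le_T P π (1/50) C x hcon
    linarith
  have eB : ∑ b ∈ B, π b = ∑ y, if 99 * T < hitTime P A y then π y else 0 := by
    rw [hBdef, Finset.sum_filter]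
  have eC : ∑ c ∈ C, π c = ∑ y, if hitTime P A y < (989/10) * T then π y else 0 := by
    rw [hCdef, Finset.sum_filter]
  have hsum := hπ.2.1
  constructor
  · have : ∑ y, π y ≤ ∑ y, Set.indicator {y | hitTime P A y ≤ 99 * T} π y + ∑ b ∈ B, π b := by
      rw [eB, ← Finset.sum_add_distrib]
      refine Finset.sum_le_sum fun y _ => ?_
      have := hπ.1 y
      simp only [Set.indicator_apply, Set.mem_setOf_eq]
      by_cases h : hitTime P A y ≤ 99 * T
      · rw [if_pos h, if_neg (not_lt.2 h)]; linarith
      · rw [if_neg h, if_pos (not_le.1 h)]; linarith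
    linarith
  · have : ∑ y, π y ≤ ∑ y, Set.indicator
        {y | (989/10) * T ≤ hitTime P A y ∧ hitTime P A y ≤ 99 * T} π y
        + ∑ b ∈ B, π b + ∑ c ∈ C, π c := by
      rw [eB, eC, ← Finset.sum_add_distrib, ← Finset.sum_add_distrib]
      refine Finset.sum_le_sum fun y _ => ?_
      have := hπ.1 y
      simp only [Set.indicator_apply, Set.mem_setOf_eq]
      by_cases h : hitTime P A y ≤ 99 * T
      · by_cases h' : (989/10) * T ≤ hitTime P A y
        · rw [if_pos ⟨h', h⟩, if_neg (not_lt.2 h), if_neg (not_lt.2 h')]; linarith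
        · rw [if_neg (fun q => h' q.1), if_neg (not_lt.2 h), if_pos (not_le.1 h')]; linarith
      · rw [if_neg (fun q => h q.2), if_pos (not_le.1 h)]
        split_ifs <;> linarith
    linarith
end
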